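/- The group G̃₃ acts freely and smoothly on S⁵ × S⁵: there exists a group homomorphism ρ from G̃₃ to the group of diffeomorphisms of S⁵ × S⁵ such that ρ(g)(x) ≠ x for every g ≠ 1 in G̃₃ and every point x of S⁵ × S⁵. -/

import Mathlib

open scoped Manifold
open Module Matrix

noncomputable section

/-- `ξ = exp(2πi/3)`. -/
def ξ : ℂ := Complex.exp (2 * Real.pi * Complex.I / 3)

/-- The cyclic permutation matrix `A`. -/
def A : Matrix (Fin 3) (Fin 3) ℂ := !![0, 1, 0; 0, 0, 1; 1, 0, 0]

/-- The diagonal matrix `B = diag(1, ξ, ξ²)`. -/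
def B : Matrix (Fin 3) (Fin 3) ℂ := !![1, 0, 0; 0, ξ, 0; 0, 0, ξ ^ 2]

/-- The group `G̃₃`: the subgroup of `U(3)` generated by `A`, `B` and the unitary scalar
matrices. -/
def Gt3 : Subgroup (Matrix.unitaryGroup (Fin 3) ℂ) :=
  Subgroup.closure {U : Matrix.unitaryGroup (Fin 3) ℂ |
    (U : Matrix (Fin 3) (Fin 3) ℂ) = A ∨ (U : Matrix (Fin 3) (Fin 3) ℂ) = B ∨
      ∃ z : ℂ, ‖z‖ = 1 ∧ (U : Matrix (Fin 3) (Fin 3) ℂ) = z • (1 : Matrix (Fin 3) (Fin 3) ℂ)}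

instance : Fact (finrank ℝ (EuclideanSpace ℂ (Fin 3)) = 5 + 1) := ⟨by
  have h1 := Module.finrank_mul_finrank ℝ ℂ (EuclideanSpace ℂ (Fin 3))
  rw [← h1, finrank_euclideanSpace_fin, Complex.finrank_real_complex]⟩

open ComplexConjugate

section PerpTrivialization

/-! For a unit vector `(a, v) ∈ ℂ × W` with `a ≠ -1`, the orthogonal complement of `(a, v)` in
`ℂ × W` is isometric to `W`, by formulas that depend smoothly on `(a, v)`. -/

variable {W : Type*} [NormedAddCommGroup W] [InnerProductSpace ℂ W]

/-- The isometry from `W` onto the orthogonal complement of `(a, v)`. -/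
def toPerp (a : ℂ) (v y : W) : ℂ × W :=
  (-(inner ℂ v y * (1 + a) / (1 + conj a)), y - (inner ℂ v y / (1 + conj a)) • v)

/-- The inverse of `toPerp a v` on the orthogonal complement of `(a, v)`. -/
def ofPerp (a : ℂ) (v : W) (w : ℂ × W) : W := w.2 - (w.1 / (1 + a)) • v

lemma one_add_conj_ne_zero {a : ℂ} (ha : 1 + a ≠ 0) : 1 + conj a ≠ 0 := by
  rw [← map_one conj, ← map_add]
  exact (map_ne_zero _).2 ha

lemma ofPerp_toPerp {a : ℂ} (ha : 1 + a ≠ 0) (v y : W) : ofPerp a v (toPerp a v y) = y := by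
  have hk := one_add_conj_ne_zero ha
  have : -(inner ℂ v y * (1 + a) / (1 + conj a)) / (1 + a) = -(inner ℂ v y / (1 + conj a)) := by
    field_simp
  simp [ofPerp, toPerp, this]

lemma toPerp_orthogonal {a : ℂ} {v : W} (ha : 1 + a ≠ 0) (hv : conj a * a + inner ℂ v v = 1)
    (y : W) : conj a * (toPerp a v y).1 + inner ℂ v (toPerp a v y).2 = 0 := by
  have hk := one_add_conj_ne_zero ha
  simp only [toPerp, inner_sub_right, inner_smul_right, eq_sub_of_add_eq' hv]
  field_simp
  ring

lemma toPerp_ofPerp {a : ℂ} {v : W} (ha : 1 + a ≠ 0) (hv : conj a * a + inner ℂ v v = 1)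
    {w : ℂ × W} (hw : conj a * w.1 + inner ℂ v w.2 = 0) : toPerp a v (ofPerp a v w) = w := by
  have hk := one_add_conj_ne_zero ha
  have h : inner ℂ v (ofPerp a v w) = -(w.1 * (1 + conj a) / (1 + a)) := by
    simp only [ofPerp, inner_sub_right, inner_smul_right, eq_sub_of_add_eq' hv,
      eq_neg_of_add_eq_zero_right hw]
    field_simp
    ring
  ext1
  · simp only [toPerp, h]
    field_simp
  · have : -(w.1 * (1 + conj a) / (1 + a)) / (1 + conj a) = -(w.1 / (1 + a)) := by
      field_simp
    simp only [toPerp, h, this]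
    simp [ofPerp]

lemma inner_toPerp_self {a : ℂ} {v : W} (ha : 1 + a ≠ 0) (hv : conj a * a + inner ℂ v v = 1)
    (y : W) : conj (toPerp a v y).1 * (toPerp a v y).1 +
      inner ℂ (toPerp a v y).2 (toPerp a v y).2 = inner ℂ y y := by
  have hk := one_add_conj_ne_zero ha
  simp only [toPerp, inner_sub_right, inner_sub_left, inner_smul_right, inner_smul_left,
    eq_sub_of_add_eq' hv, map_neg, map_mul, map_div₀, map_add, map_one, Complex.conj_conj,
    inner_conj_symm]
  field_simp
  ring

end PerpTrivialization

lemma ξ_isPrimitiveRoot : IsPrimitiveRoot ξ 3 := by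
  simpa [ξ] using Complex.isPrimitiveRoot_exp 3 (by norm_num)

lemma ξ_pow_three : ξ ^ 3 = 1 := ξ_isPrimitiveRoot.pow_eq_one

lemma one_add_ξ_add_sq : 1 + ξ + ξ ^ 2 = 0 := by
  simpa [Finset.sum_range_succ] using ξ_isPrimitiveRoot.geom_sum_eq_zero (by norm_num)

lemma conj_mul_self_of_pow_three {α : ℂ} (hα : α ^ 3 = 1) : conj α * α = 1 := by
  rw [mul_comm, Complex.mul_conj, Complex.normSq_eq_norm_sq,
    Complex.norm_eq_one_of_pow_eq_one hα (by norm_num)]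
  simp

lemma conj_ξ : conj ξ = ξ ^ 2 := by
  have h := conj_mul_self_of_pow_three ξ_pow_three
  linear_combination ξ ^ 2 * h - conj ξ * ξ_pow_three

lemma ξ_re : ξ.re = -1 / 2 := by
  have h := congrArg Complex.re one_add_ξ_add_sq
  rw [← conj_ξ] at h
  simp only [Complex.add_re, Complex.one_re, Complex.conj_re, Complex.zero_re] at h
  linarith

/-- `g` commutes with `A` and `B` up to the cube roots of unity `α` and `β`. -/
structure IsWeight (g : Matrix (Fin 3) (Fin 3) ℂ) (α β : ℂ) : Prop where
  pow_left : α ^ 3 = 1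
  pow_right : β ^ 3 = 1
  A_mul : A * g = α • (g * A)
  B_mul : B * g = β • (g * B)

lemma A_mul_B : A * B = ξ • (B * A) := by
  ext i j
  fin_cases i <;> fin_cases j <;> simp [A, B, Matrix.mul_apply, Fin.sum_univ_three]
  · ring
  · linear_combination -ξ_pow_three

lemma B_mul_A : B * A = ξ ^ 2 • (A * B) := by
  rw [A_mul_B, smul_smul, ← pow_succ, ξ_pow_three, one_smul]

lemma det_A : A.det = 1 := by simp [A, Matrix.det_fin_three]

lemma det_B : B.det = 1 := by
  simp [B, Matrix.det_fin_three]
  linear_combination ξ_pow_three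

namespace IsWeight

variable {g h : Matrix (Fin 3) (Fin 3) ℂ} {α β α' β' : ℂ}

lemma mul (hg : IsWeight g α β) (hh : IsWeight h α' β') :
    IsWeight (g * h) (α * α') (β * β') where
  pow_left := by rw [mul_pow, hg.pow_left, hh.pow_left, one_mul]
  pow_right := by rw [mul_pow, hg.pow_right, hh.pow_right, one_mul]
  A_mul := by
    rw [← mul_assoc, hg.A_mul, smul_mul_assoc, mul_assoc, hh.A_mul, mul_smul_comm, smul_smul,
      mul_assoc]
  B_mul := by
    rw [← mul_assoc, hg.B_mul, smul_mul_assoc, mul_assoc, hh.B_mul, mul_smul_comm, smul_smul,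
      mul_assoc]

lemma inv_of_mul_eq_one (hg : IsWeight g α β) (hgh : g * h = 1) (hhg : h * g = 1) :
    IsWeight h (α ^ 2) (β ^ 2) := by
  have key : ∀ {P : Matrix (Fin 3) (Fin 3) ℂ} {c : ℂ}, c ^ 3 = 1 → P * g = c • (g * P) →
      P * h = c ^ 2 • (h * P) := by
    intro P c hc hP
    have h1 : h * (P * g) * h = c • (P * h) := by
      rw [hP, mul_smul_comm, ← mul_assoc, hhg, one_mul, smul_mul_assoc]
    have h2 : h * (P * g) * h = h * P := by simp only [mul_assoc, hgh, mul_one]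
    rw [← h2, h1, smul_smul, ← pow_succ, hc, one_smul]
  exact ⟨by rw [← pow_mul, mul_comm, pow_mul, hg.pow_left, one_pow],
    by rw [← pow_mul, mul_comm, pow_mul, hg.pow_right, one_pow],
    key hg.pow_left hg.A_mul, key hg.pow_right hg.B_mul⟩

lemma unique (hdet : g.det ≠ 0) (hg : IsWeight g α β) (hg' : IsWeight g α' β') :
    α = α' ∧ β = β' := by
  have key : ∀ {P : Matrix (Fin 3) (Fin 3) ℂ} {c c' : ℂ}, P.det = 1 → P * g = c • (g * P) →
      P * g = c' • (g * P) → c = c' := by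
    intro P c c' hP h1 h2
    refine smul_left_injective ℂ (fun h0 : g * P = 0 => ?_) (h1.symm.trans h2)
    have := congrArg Matrix.det h0
    rw [Matrix.det_mul, hP, mul_one, Matrix.det_zero] at this
    exact hdet this
  exact ⟨key det_A hg.A_mul hg'.A_mul, key det_B hg.B_mul hg'.B_mul⟩

lemma eq_smul_one (hg : IsWeight g 1 1) : g = g 0 0 • (1 : Matrix (Fin 3) (Fin 3) ℂ) := by
  have hA := hg.A_mul
  have hB := hg.B_mul
  have h1 : ξ - 1 ≠ 0 := sub_ne_zero.2 (ξ_isPrimitiveRoot.ne_one (by norm_num))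
  have h2 : ξ ≠ 0 := ξ_isPrimitiveRoot.ne_zero (by norm_num)
  have h3 : ξ + 1 ≠ 0 := fun h => pow_ne_zero 2 h2 (by linear_combination one_add_ξ_add_sq - h)
  rw [one_smul] at hA hB
  have a (i j) := congrFun (congrFun hA i) j
  have b (i j) := congrFun (congrFun hB i) j
  have a01 := a 0 1
  have a12 := a 1 2
  have b01 := b 0 1
  have b02 := b 0 2
  have b10 := b 1 0
  have b12 := b 1 2
  have b20 := b 2 0
  have b21 := b 2 1
  simp [A, B, Matrix.mul_apply, Fin.sum_univ_three] at a01 a12 b01 b02 b10 b12 b20 b21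
  have e01 : g 0 1 = 0 := by
    refine (mul_eq_zero.1 (?_ : (ξ - 1) * g 0 1 = 0)).resolve_left h1
    linear_combination -b01
  have e10 : g 1 0 = 0 := by
    refine (mul_eq_zero.1 (?_ : (ξ - 1) * g 1 0 = 0)).resolve_left h1
    linear_combination b10
  have e02 : g 0 2 = 0 := by
    refine (mul_eq_zero.1 (?_ : ((ξ - 1) * (ξ + 1)) * g 0 2 = 0)).resolve_left (mul_ne_zero h1 h3)
    linear_combination -b02
  have e20 : g 2 0 = 0 := by
    refine (mul_eq_zero.1 (?_ : ((ξ - 1) * (ξ + 1)) * g 2 0 = 0)).resolve_left (mul_ne_zero h1 h3)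
    linear_combination b20
  have e12 : g 1 2 = 0 := by
    refine (mul_eq_zero.1 (?_ : (ξ * (ξ - 1)) * g 1 2 = 0)).resolve_left (mul_ne_zero h2 h1)
    linear_combination -b12
  have e21 : g 2 1 = 0 := by
    refine (mul_eq_zero.1 (?_ : (ξ * (ξ - 1)) * g 2 1 = 0)).resolve_left (mul_ne_zero h2 h1)
    linear_combination b21
  ext i j
  fin_cases i <;> fin_cases j <;> simp [e01, e10, e02, e20, e12, e21, a01, a12]

end IsWeight

lemma exists_isWeight (g : Gt3) :
    ∃ c : ℂ × ℂ, IsWeight (g : Matrix.unitaryGroup (Fin 3) ℂ) c.1 c.2 := by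
  obtain ⟨g, hg⟩ := g
  induction hg using Subgroup.closure_induction with
  | mem U hU =>
    rcases hU with hU | hU | ⟨z, -, hU⟩ <;> dsimp only <;> rw [hU]
    · exact ⟨(1, ξ ^ 2), one_pow 3, by rw [← pow_mul, mul_comm, pow_mul, ξ_pow_three, one_pow],
        (one_smul _ _).symm, B_mul_A⟩
    · exact ⟨(ξ, 1), ξ_pow_three, one_pow 3, A_mul_B, (one_smul _ _).symm⟩
    · exact ⟨(1, 1), one_pow 3, one_pow 3, by simp, by simp⟩
  | one => exact ⟨(1, 1), one_pow 3, one_pow 3, by simp, by simp⟩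
  | mul g h _ _ hg hh =>
    obtain ⟨c, hc⟩ := hg
    obtain ⟨d, hd⟩ := hh
    exact ⟨(_, _), hc.mul hd⟩
  | inv g _ hg =>
    obtain ⟨c, hc⟩ := hg
    exact ⟨(_, _), hc.inv_of_mul_eq_one (congrArg Subtype.val (mul_inv_cancel g))
      (congrArg Subtype.val (inv_mul_cancel g))⟩

/-- The characters of `G̃₃` by which it commutes with `A` and with `B`. -/
def weight (g : Gt3) : ℂ × ℂ := (exists_isWeight g).choose

lemma isWeight_weight (g : Gt3) :
    IsWeight (g : Matrix.unitaryGroup (Fin 3) ℂ) (weight g).1 (weight g).2 :=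
  (exists_isWeight g).choose_spec

lemma weight_eq {g : Gt3} {α β : ℂ} (h : IsWeight (g : Matrix.unitaryGroup (Fin 3) ℂ) α β) :
    weight g = (α, β) :=
  Prod.ext_iff.2 <| (isWeight_weight g).unique
    (Matrix.UnitaryGroup.det_isUnit (g : Matrix.unitaryGroup (Fin 3) ℂ)).ne_zero h

lemma weight_one : weight 1 = 1 :=
  weight_eq ⟨one_pow 3, one_pow 3, by simp, by simp⟩

lemma weight_mul (g h : Gt3) : weight (g * h) = weight g * weight h :=
  weight_eq ((isWeight_weight g).mul (isWeight_weight h))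

local notation "V" => EuclideanSpace ℂ (Fin 3)

local notation "S5" => Metric.sphere (0 : EuclideanSpace ℂ (Fin 3)) 1

local notation "act" => Matrix.toEuclideanCLM (n := Fin 3) (𝕜 := ℂ)

lemma act_mul (M N : Matrix (Fin 3) (Fin 3) ℂ) (x : V) : act (M * N) x = act M (act N x) := by
  rw [map_mul]
  rfl

lemma inner_act_act {U : Matrix (Fin 3) (Fin 3) ℂ} (hU : star U * U = 1) (x y : V) :
    inner ℂ (act U x) (act U y) = inner ℂ x y := by
  rw [← ContinuousLinearMap.adjoint_inner_right, ← ContinuousLinearMap.star_eq_adjoint,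
    ← map_star, ← act_mul, hU, map_one]
  rfl

lemma inner_act_of_mul_eq_smul {P U : Matrix (Fin 3) (Fin 3) ℂ} {c : ℂ} (hU : star U * U = 1)
    (h : P * U = c • (U * P)) (x : V) :
    inner ℂ (act U x) (act P (act U x)) = c * inner ℂ x (act P x) := by
  rw [← act_mul, h, map_smul, _root_.smul_apply, act_mul, inner_smul_right, inner_act_act hU]

lemma norm_act {U : Matrix (Fin 3) (Fin 3) ℂ} (hU : star U * U = 1) (x : V) :
    ‖act U x‖ = ‖x‖ := by
  rw [norm_eq_sqrt_re_inner (𝕜 := ℂ), norm_eq_sqrt_re_inner (𝕜 := ℂ), inner_act_act hU]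

/-- The first coordinate of the equivariant map `S⁵ → S⁷ ⊆ ℂ × ℂ³`. -/
def sec₀ (x : V) : ℂ := inner ℂ x (act B x)

/-- The last three coordinates of the equivariant map `S⁵ → S⁷ ⊆ ℂ × ℂ³`. -/
def sec (x : V) : V := WithLp.toLp 2 fun i => inner ℂ x (act (A * B ^ (i : ℕ)) x)

/-- The diagonal matrix by which an element of weight `c` acts on the last three coordinates
of `ℂ × ℂ³`. -/
def diagWeight (c : ℂ × ℂ) : Matrix (Fin 3) (Fin 3) ℂ :=
  Matrix.diagonal fun i => c.1 * c.2 ^ (i : ℕ)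

/-- An element of weight `c` acts diagonally on `ℂ × ℂ³`. -/
def weightAct (c : ℂ × ℂ) (w : ℂ × V) : ℂ × V := (c.2 * w.1, act (diagWeight c) w.2)

lemma weightAct_one (w : ℂ × V) : weightAct 1 w = w := by
  simp [weightAct, diagWeight]

lemma weightAct_mul (c d : ℂ × ℂ) (w : ℂ × V) :
    weightAct (c * d) w = weightAct c (weightAct d w) := by
  have : diagWeight (c * d) = diagWeight c * diagWeight d := by
    rw [diagWeight, diagWeight, diagWeight, Matrix.diagonal_mul_diagonal]
    congr 1
    ext i
    simp only [Prod.fst_mul, Prod.snd_mul]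
    ring
  rw [weightAct, this, act_mul]
  simp only [weightAct, Prod.snd_mul, mul_assoc]

lemma star_diagWeight_mul_self {c : ℂ × ℂ} (h₁ : c.1 ^ 3 = 1) (h₂ : c.2 ^ 3 = 1) :
    star (diagWeight c) * diagWeight c = 1 := by
  rw [diagWeight, Matrix.star_eq_conjTranspose, Matrix.diagonal_conjTranspose,
    Matrix.diagonal_mul_diagonal, Matrix.diagonal_eq_one]
  ext i
  have : (c.1 * c.2 ^ (i : ℕ)) ^ 3 = 1 := by
    rw [mul_pow, ← pow_mul, mul_comm _ 3, pow_mul, h₁, h₂, one_pow, one_mul]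
  simpa using conj_mul_self_of_pow_three this

lemma IsWeight.mul_A_mul_B_pow {g : Matrix (Fin 3) (Fin 3) ℂ} {α β : ℂ} (hg : IsWeight g α β)
    (n : ℕ) : A * B ^ n * g = (α * β ^ n) • (g * (A * B ^ n)) := by
  have hB : B ^ n * g = β ^ n • (g * B ^ n) := by
    induction n with
    | zero => simp
    | succ n ih =>
      rw [pow_succ, mul_assoc, hg.B_mul, mul_smul_comm, ← mul_assoc, ih, smul_mul_assoc, smul_smul,
        mul_assoc, pow_succ, mul_comm β]
  rw [mul_assoc, hB, mul_smul_comm, ← mul_assoc, hg.A_mul, smul_mul_assoc, smul_smul, mul_assoc,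
    mul_comm α]

lemma sec₀_act {g : Matrix (Fin 3) (Fin 3) ℂ} {c : ℂ × ℂ} (hU : star g * g = 1)
    (hg : IsWeight g c.1 c.2) (x : V) : sec₀ (act g x) = c.2 * sec₀ x :=
  inner_act_of_mul_eq_smul hU hg.B_mul x

lemma sec_act {g : Matrix (Fin 3) (Fin 3) ℂ} {c : ℂ × ℂ} (hU : star g * g = 1)
    (hg : IsWeight g c.1 c.2) (x : V) : sec (act g x) = act (diagWeight c) (sec x) := by
  ext i
  simp only [sec, diagWeight, Matrix.toEuclideanCLM_toLp, Matrix.mulVec_diagonal]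
  exact inner_act_of_mul_eq_smul hU (hg.mul_A_mul_B_pow i) x

lemma sec₀_eq (x : V) :
    sec₀ x = conj (x 0) * x 0 + ξ * (conj (x 1) * x 1) + ξ ^ 2 * (conj (x 2) * x 2) := by
  simp [sec₀, PiLp.inner_apply, Fin.sum_univ_three, B, Matrix.mulVec, dotProduct]
  ring

lemma sec_eq (x : V) (i : Fin 3) :
    sec x i = ξ ^ (i : ℕ) * (conj (x 0) * x 1) + ξ ^ (2 * (i : ℕ)) * (conj (x 1) * x 2)
      + conj (x 2) * x 0 := by
  have hB : B = Matrix.diagonal ![1, ξ, ξ ^ 2] := by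
    ext i j
    fin_cases i <;> fin_cases j <;> simp [B]
  simp only [sec, hB, Matrix.diagonal_pow, act_mul, PiLp.inner_apply, Fin.sum_univ_three,
    RCLike.inner_apply, Matrix.ofLp_toEuclideanCLM, A, Matrix.mulVec,
    Matrix.vec3_dotProduct]
  simp [← pow_mul]
  ring

lemma sum_conj_mul_self {x : V} (hx : ‖x‖ = 1) :
    conj (x 0) * x 0 + conj (x 1) * x 1 + conj (x 2) * x 2 = 1 := by
  have h := inner_self_eq_norm_sq_to_K (𝕜 := ℂ) x
  rw [hx, PiLp.inner_apply] at h
  simp only [Fin.sum_univ_three, RCLike.inner_apply, RCLike.ofReal_one, one_pow] at h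
  linear_combination h

lemma sec_unit {x : V} (hx : ‖x‖ = 1) :
    conj (sec₀ x) * sec₀ x + inner ℂ (sec x) (sec x) = 1 := by
  have h := sum_conj_mul_self hx
  rw [PiLp.inner_apply]
  simp only [Fin.sum_univ_three, RCLike.inner_apply, sec₀_eq, sec_eq, map_add, map_mul, map_pow,
    conj_ξ, Complex.conj_conj, Fin.val_zero, Fin.val_one, Fin.val_two]
  linear_combination (conj (x 0) * x 0 + conj (x 1) * x 1 + conj (x 2) * x 2 + 1) * h +
    ((ξ ^ 4 - ξ ^ 3 + 2 * ξ - 1) * conj (x 0) * conj (x 1) * x 0 * x 1 +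
      (ξ ^ 2 - ξ + 1) * conj (x 0) * conj (x 2) * x 0 * x 2 +
      (ξ - 1) * conj (x 1) * conj (x 1) * x 1 * x 1 +
      (ξ ^ 10 - ξ ^ 9 + ξ ^ 7 - ξ ^ 6 + 2 * ξ ^ 4 - ξ ^ 3 + ξ - 1) *
        conj (x 1) * conj (x 2) * x 1 * x 2 +
      (ξ ^ 4 - ξ ^ 3 + ξ - 1) * conj (x 2) * conj (x 2) * x 2 * x 2 +
      (ξ ^ 8 - ξ ^ 7 + ξ ^ 5 - ξ ^ 4 + ξ ^ 3 - ξ + 1) * conj (x 0) * conj (x 2) * x 1 * x 1 +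
      conj (x 0) * conj (x 0) * x 1 * x 2 +
      (ξ ^ 6 - ξ ^ 5 + ξ ^ 3 - ξ + 1) * conj (x 1) * conj (x 1) * x 0 * x 2 +
      (ξ ^ 2 - ξ + 1) * conj (x 0) * conj (x 1) * x 2 * x 2 +
      (ξ ^ 2 - ξ + 1) * conj (x 1) * conj (x 2) * x 0 * x 0 +
      (ξ ^ 6 - ξ ^ 5 + ξ ^ 3 - ξ + 1) * conj (x 2) * conj (x 2) * x 0 * x 1) * one_add_ξ_add_sq

lemma one_add_sec₀_ne_zero {x : V} (hx : ‖x‖ = 1) : 1 + sec₀ x ≠ 0 := by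
  intro h0
  have h := congrArg Complex.re (sum_conj_mul_self hx)
  have h1 := congrArg Complex.re h0
  rw [sec₀_eq, ← conj_ξ] at h1
  simp [Complex.mul_re, ξ_re] at h h1
  nlinarith [sq_nonneg (x 0).re, sq_nonneg (x 0).im]

/-- The action on pairs of vectors. -/
def pairAct (g : Gt3) (p : V × V) : V × V :=
  (act (g : Matrix.unitaryGroup (Fin 3) ℂ) p.1,
    ofPerp (sec₀ (act (g : Matrix.unitaryGroup (Fin 3) ℂ) p.1))
      (sec (act (g : Matrix.unitaryGroup (Fin 3) ℂ) p.1))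
      (weightAct (weight g) (toPerp (sec₀ p.1) (sec p.1) p.2)))

lemma star_coe_mul_self (g : Gt3) :
    star ((g : Matrix.unitaryGroup (Fin 3) ℂ) : Matrix (Fin 3) (Fin 3) ℂ) *
      ((g : Matrix.unitaryGroup (Fin 3) ℂ) : Matrix (Fin 3) (Fin 3) ℂ) = 1 :=
  Matrix.UnitaryGroup.star_mul_self _

lemma weightAct_orthogonal (g : Gt3) (x : V) {w : ℂ × V}
    (hw : conj (sec₀ x) * w.1 + inner ℂ (sec x) w.2 = 0) :
    conj (sec₀ (act (g : Matrix.unitaryGroup (Fin 3) ℂ) x)) * (weightAct (weight g) w).1 +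
      inner ℂ (sec (act (g : Matrix.unitaryGroup (Fin 3) ℂ) x)) (weightAct (weight g) w).2 = 0 := by
  have hg := isWeight_weight g
  rw [sec₀_act (star_coe_mul_self g) hg, sec_act (star_coe_mul_self g) hg]
  simp only [weightAct, inner_act_act (star_diagWeight_mul_self hg.pow_left hg.pow_right), map_mul]
  linear_combination hw + conj (sec₀ x) * w.1 * conj_mul_self_of_pow_three hg.pow_right

lemma toPerp_pairAct (g : Gt3) {p : V × V} (hp : ‖p.1‖ = 1) :
    toPerp (sec₀ (pairAct g p).1) (sec (pairAct g p).1) (pairAct g p).2 =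
      weightAct (weight g) (toPerp (sec₀ p.1) (sec p.1) p.2) := by
  have hgp : ‖act (g : Matrix.unitaryGroup (Fin 3) ℂ) p.1‖ = 1 := by
    rw [norm_act (star_coe_mul_self g), hp]
  exact toPerp_ofPerp (one_add_sec₀_ne_zero hgp) (sec_unit hgp)
    (weightAct_orthogonal g p.1 (toPerp_orthogonal (one_add_sec₀_ne_zero hp) (sec_unit hp) _))

lemma norm_pairAct_fst (g : Gt3) (p : V × V) : ‖(pairAct g p).1‖ = ‖p.1‖ :=
  norm_act (star_coe_mul_self g) _

lemma norm_pairAct_snd (g : Gt3) {p : V × V} (hp : ‖p.1‖ = 1) : ‖(pairAct g p).2‖ = ‖p.2‖ := by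
  have hg := isWeight_weight g
  have hgp := (norm_pairAct_fst g p).trans hp
  rw [norm_eq_sqrt_re_inner (𝕜 := ℂ), norm_eq_sqrt_re_inner (𝕜 := ℂ),
    ← inner_toPerp_self (one_add_sec₀_ne_zero hgp) (sec_unit hgp), toPerp_pairAct g hp,
    ← inner_toPerp_self (one_add_sec₀_ne_zero hp) (sec_unit hp) p.2]
  simp only [weightAct, inner_act_act (star_diagWeight_mul_self hg.pow_left hg.pow_right), map_mul]
  congr 2
  linear_combination conj (toPerp (sec₀ p.1) (sec p.1) p.2).1 *
    (toPerp (sec₀ p.1) (sec p.1) p.2).1 * conj_mul_self_of_pow_three hg.pow_right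

lemma pairAct_one {p : V × V} (hp : ‖p.1‖ = 1) : pairAct 1 p = p := by
  ext1
  · simp [pairAct]
  · simp [pairAct, weight_one, weightAct_one, ofPerp_toPerp (one_add_sec₀_ne_zero hp)]

lemma pairAct_mul (g h : Gt3) {p : V × V} (hp : ‖p.1‖ = 1) :
    pairAct (g * h) p = pairAct g (pairAct h p) := by
  conv_rhs => rw [pairAct]
  rw [toPerp_pairAct h hp, ← weightAct_mul, ← weight_mul, pairAct, pairAct]
  simp only [Subgroup.coe_mul, Matrix.UnitaryGroup.mul_val, act_mul]

lemma contDiff_act (M : Matrix (Fin 3) (Fin 3) ℂ) : ContDiff ℝ (⊤ : ℕ∞) (act M) :=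
  ((act M).restrictScalars ℝ).contDiff

lemma contDiff_sec₀ : ContDiff ℝ (⊤ : ℕ∞) sec₀ :=
  contDiff_id.inner ℂ (contDiff_act B)

lemma contDiff_sec : ContDiff ℝ (⊤ : ℕ∞) sec :=
  contDiff_piLp' 2 fun i => contDiff_id.inner ℂ (contDiff_act (A * B ^ (i : ℕ)))

lemma contDiffAt_pairAct (g : Gt3) {p : V × V} (hp : ‖p.1‖ = 1) :
    ContDiffAt ℝ (⊤ : ℕ∞) (pairAct g) p := by
  have hk := one_add_sec₀_ne_zero hp
  have hgk := one_add_sec₀_ne_zero ((norm_pairAct_fst g p).trans hp)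
  have hconj : ContDiff ℝ (⊤ : ℕ∞) fun q : V × V => conj (sec₀ q.1) :=
    Complex.conjCLE.contDiff.comp (contDiff_sec₀.comp contDiff_fst)
  have h₀ : ContDiff ℝ (⊤ : ℕ∞) fun q : V × V => sec₀ q.1 := contDiff_sec₀.comp contDiff_fst
  have h₁ : ContDiff ℝ (⊤ : ℕ∞) fun q : V × V => sec q.1 := contDiff_sec.comp contDiff_fst
  have hi : ContDiff ℝ (⊤ : ℕ∞) fun q : V × V => (inner ℂ (sec q.1) q.2 : ℂ) :=
    h₁.inner ℂ contDiff_snd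
  have hg : ContDiff ℝ (⊤ : ℕ∞) fun q : V × V => (pairAct g q).1 :=
    (contDiff_act _).comp contDiff_fst
  have hd : ContDiffAt ℝ (⊤ : ℕ∞) (fun q : V × V => (1 + conj (sec₀ q.1))⁻¹) p :=
    (contDiff_const.add hconj).contDiffAt.inv (one_add_conj_ne_zero hk)
  have hd' : ContDiffAt ℝ (⊤ : ℕ∞) (fun q : V × V => (1 + sec₀ (pairAct g q).1)⁻¹) p :=
    (contDiff_const.add (contDiff_sec₀.comp hg)).contDiffAt.inv hgk
  have ht₁ : ContDiffAt ℝ (⊤ : ℕ∞) (fun q : V × V => (toPerp (sec₀ q.1) (sec q.1) q.2).1) p :=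
    ((hi.mul (contDiff_const.add h₀)).contDiffAt.mul hd).neg
  have ht₂ : ContDiffAt ℝ (⊤ : ℕ∞) (fun q : V × V => (toPerp (sec₀ q.1) (sec q.1) q.2).2) p :=
    contDiffAt_snd.sub ((hi.contDiffAt.mul hd).smul h₁.contDiffAt)
  exact hg.contDiffAt.prodMk <| ((contDiff_act _).contDiffAt.comp p ht₂).sub
    (((contDiffAt_const.mul ht₁).mul hd').smul (contDiff_sec.comp hg).contDiffAt)

/-- No nontrivial weight fixes two orthogonal unit vectors of `ℂ × ℂ³`. -/
lemma weight_eq_one_of_fixed {c : ℂ × ℂ} {w : ℂ × V} {a : ℂ} {v : V} (h₂ : c.2 ^ 3 = 1)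
    (hw : w = weightAct c w) (ha : a = c.2 * a) (hv : v = act (diagWeight c) v)
    (hsu : conj a * a + inner ℂ v v = 1) (hunit : conj w.1 * w.1 + inner ℂ w.2 w.2 = 1)
    (hort : conj a * w.1 + inner ℂ v w.2 = 0) : c = 1 := by
  obtain ⟨α, β⟩ := c
  obtain ⟨w₀, w⟩ := w
  have hw₀ : w₀ = β * w₀ := congrArg Prod.fst hw
  have hw' : w = act (diagWeight (α, β)) w := congrArg Prod.snd hw
  clear hw
  dsimp only at *
  simp only [PiLp.inner_apply, Fin.sum_univ_three, RCLike.inner_apply] at hsu hunit hort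
  have fixed : ∀ {u : V}, u = act (diagWeight (α, β)) u →
      ∀ i : Fin 3, α * β ^ (i : ℕ) ≠ 1 → u i = 0 := by
    intro u hu i hi
    have := congrArg (fun x : V => x i) hu
    simp only [diagWeight, Matrix.ofLp_toEuclideanCLM, Matrix.mulVec_diagonal] at this
    refine (mul_eq_zero.1 (?_ : (1 - α * β ^ (i : ℕ)) * u i = 0)).resolve_left
      (sub_ne_zero.2 hi.symm)
    linear_combination this
  have absurd_of : ∀ {y z : ℂ}, conj y * y = 1 → conj z * z = 1 → conj y * z = 0 → False := by
    intro y z hy hz hyz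
    rcases mul_eq_zero.1 hyz with h | h
    · simp [h] at hy
    · simp [h] at hz
  by_contra hne
  have hw0 := fixed hw' 0
  have hw1 := fixed hw' 1
  have hw2 := fixed hw' 2
  have hv0 := fixed hv 0
  have hv1 := fixed hv 1
  have hv2 := fixed hv 2
  simp only [Fin.val_zero, Fin.val_one, Fin.val_two, pow_zero, pow_one, mul_one]
    at hw0 hw1 hw2 hv0 hv1 hv2
  by_cases hβ : β = 1
  · subst hβ
    have hα : α ≠ 1 := fun hα => hne (by rw [hα]; rfl)
    simp only [one_pow, mul_one] at hw1 hw2 hv1 hv2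
    simp only [hw0 hα, hw1 hα, hw2 hα, hv0 hα, hv1 hα, hv2 hα, zero_mul, add_zero]
      at hsu hunit hort
    exact absurd_of hsu hunit hort
  · have hβ2 : β ^ 2 ≠ 1 := fun h => hβ (by linear_combination h₂ - β * h)
    have e₁ : a = 0 := by
      refine (mul_eq_zero.1 (?_ : (1 - β) * a = 0)).resolve_left (sub_ne_zero.2 (Ne.symm hβ))
      linear_combination ha
    have e₂ : w₀ = 0 := by
      refine (mul_eq_zero.1 (?_ : (1 - β) * w₀ = 0)).resolve_left (sub_ne_zero.2 (Ne.symm hβ))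
      linear_combination hw₀
    simp only [e₁, e₂, mul_zero, zero_add] at hsu hunit hort
    by_cases hα : α = 1
    · rw [hα, one_mul] at hw1 hv1 hw2 hv2
      simp only [hw1 hβ, hv1 hβ, hw2 hβ2, hv2 hβ2, zero_mul, add_zero] at hsu hunit hort
      exact absurd_of (by linear_combination hsu) (by linear_combination hunit)
        (by linear_combination hort)
    · simp only [hw0 hα, hv0 hα, zero_mul, zero_add] at hsu hunit hort
      by_cases hαβ : α * β = 1
      · have h : α * β ^ 2 ≠ 1 := fun h => hβ (by linear_combination h - β * hαβ)
        simp only [hw2 h, hv2 h, zero_mul, add_zero] at hsu hunit hort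
        exact absurd_of (by linear_combination hsu) (by linear_combination hunit)
          (by linear_combination hort)
      · simp only [hw1 hαβ, hv1 hαβ, zero_mul, zero_add] at hsu hunit hort
        exact absurd_of (by linear_combination hsu) (by linear_combination hunit)
          (by linear_combination hort)

lemma eq_one_of_pairAct_eq {g : Gt3} {p : V × V} (hp₁ : ‖p.1‖ = 1) (hp₂ : ‖p.2‖ = 1)
    (h : pairAct g p = p) : g = 1 := by
  have hg := isWeight_weight g
  have hU := star_coe_mul_self g
  have hx : act (g : Matrix.unitaryGroup (Fin 3) ℂ) p.1 = p.1 := congrArg Prod.fst h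
  have ha := sec₀_act hU hg p.1
  have hv := sec_act hU hg p.1
  have hk := one_add_sec₀_ne_zero hp₁
  have hw := toPerp_pairAct g hp₁
  have hunit := inner_toPerp_self hk (sec_unit hp₁) p.2
  rw [hx] at ha hv
  rw [h] at hw
  rw [inner_self_eq_norm_sq_to_K p.2, hp₂, RCLike.ofReal_one, one_pow] at hunit
  have hone := weight_eq_one_of_fixed hg.pow_right hw ha hv (sec_unit hp₁) hunit
    (toPerp_orthogonal hk (sec_unit hp₁) p.2)
  rw [hone] at hg
  have hsmul := hg.eq_smul_one
  have hz : ((g : Matrix.unitaryGroup (Fin 3) ℂ) : Matrix (Fin 3) (Fin 3) ℂ) 0 0 = 1 := by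
    rw [hsmul, map_smul, map_one] at hx
    refine smul_left_injective ℂ (norm_ne_zero_iff.1 (hp₁.trans_ne one_ne_zero)) ?_
    simpa using hx
  rw [hz, one_smul] at hsmul
  exact Subtype.ext (Subtype.ext hsmul)

lemma contMDiff_pairAct (g : Gt3) :
    ContMDiff ((𝓡 5).prod (𝓡 5)) 𝓘(ℝ, V × V) (⊤ : ℕ∞)
      fun p : S5 × S5 => pairAct g (p.1, p.2) := by
  intro p
  have hp : ‖(p.1 : V)‖ = 1 := by simp
  have h₁ : ContMDiff ((𝓡 5).prod (𝓡 5)) 𝓘(ℝ, V) (⊤ : ℕ∞) fun p : S5 × S5 => (p.1 : V) :=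
    contMDiff_coe_sphere.comp contMDiff_fst
  have h₂ : ContMDiff ((𝓡 5).prod (𝓡 5)) 𝓘(ℝ, V) (⊤ : ℕ∞) fun p : S5 × S5 => (p.2 : V) :=
    contMDiff_coe_sphere.comp contMDiff_snd
  exact ContMDiffAt.comp p
    (contDiffAt_pairAct g (p := ((p.1 : V), (p.2 : V))) hp).contMDiffAt
    ((h₁ p).prodMk_space (h₂ p))

lemma pairAct_fst_mem (g : Gt3) (p : S5 × S5) : (pairAct g (p.1, p.2)).1 ∈ S5 := by
  simp [norm_pairAct_fst]

lemma pairAct_snd_mem (g : Gt3) (p : S5 × S5) : (pairAct g (p.1, p.2)).2 ∈ S5 := by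
  simp [norm_pairAct_snd]

/-- The action on pairs of unit vectors. -/
def sphereAct (g : Gt3) (p : S5 × S5) : S5 × S5 :=
  (⟨_, pairAct_fst_mem g p⟩, ⟨_, pairAct_snd_mem g p⟩)

lemma sphereAct_one (p : S5 × S5) : sphereAct 1 p = p := by
  have h := pairAct_one (p := ((p.1 : V), (p.2 : V))) (by simp)
  exact Prod.ext (Subtype.ext (congrArg Prod.fst h)) (Subtype.ext (congrArg Prod.snd h))

lemma sphereAct_mul (g h : Gt3) (p : S5 × S5) :
    sphereAct (g * h) p = sphereAct g (sphereAct h p) := by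
  have h := pairAct_mul g h (p := ((p.1 : V), (p.2 : V))) (by simp)
  exact Prod.ext (Subtype.ext (congrArg Prod.fst h)) (Subtype.ext (congrArg Prod.snd h))

lemma contMDiff_sphereAct (g : Gt3) :
    ContMDiff ((𝓡 5).prod (𝓡 5)) ((𝓡 5).prod (𝓡 5)) (⊤ : ℕ∞) (sphereAct g) :=
  (ContMDiff.codRestrict_sphere (contDiff_fst.contMDiff.comp (contMDiff_pairAct g))
    (pairAct_fst_mem g)).prodMk
  (ContMDiff.codRestrict_sphere (contDiff_snd.contMDiff.comp (contMDiff_pairAct g))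
    (pairAct_snd_mem g))

/-- Theorem C: `G̃₃` acts freely and smoothly on `S⁵ × S⁵`. -/
theorem Gt3_acts_freely_smoothly_on_S5xS5 :
    ∃ ρ : Gt3 → Diffeomorph ((𝓡 5).prod (𝓡 5)) ((𝓡 5).prod (𝓡 5))
        ((Metric.sphere (0 : EuclideanSpace ℂ (Fin 3)) 1) × (Metric.sphere (0 : EuclideanSpace ℂ (Fin 3)) 1))
        ((Metric.sphere (0 : EuclideanSpace ℂ (Fin 3)) 1) × (Metric.sphere (0 : EuclideanSpace ℂ (Fin 3)) 1)) (⊤ : ℕ∞),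
      (∀ g h : Gt3, ∀ x, ρ (g * h) x = ρ g (ρ h x)) ∧
      (∀ g : Gt3, g ≠ 1 → ∀ x, ρ g x ≠ x) := by
  refine ⟨fun g => ⟨⟨sphereAct g, sphereAct g⁻¹, fun x => ?_, fun x => ?_⟩,
    contMDiff_sphereAct g, contMDiff_sphereAct g⁻¹⟩, fun g h x => sphereAct_mul g h x,
    fun g hg x hx => hg ?_⟩
  · rw [← sphereAct_mul, inv_mul_cancel, sphereAct_one]
  · rw [← sphereAct_mul, mul_inv_cancel, sphereAct_one]
  · have hx' : sphereAct g x = x := hx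
    exact eq_one_of_pairAct_eq (p := ((x.1 : V), (x.2 : V))) (by simp) (by simp)
      (Prod.ext (congrArg (fun q => (q.1 : V)) hx') (congrArg (fun q => (q.2 : V)) hx'))
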